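/- Let A be a finite dimensional k-algebra which is not a Nakayama algebra and suppose all projective indecomposable A-modules have the same Loewy length. Then there exists a simple A-module S such that ∑_T dim_k Ext¹_A(T, S) ≥ 2, where T ranges over representatives of the isomorphism classes of simple A-modules. -/

import Mathlib

set_option maxHeartbeats 1000000
set_option synthInstance.maxHeartbeats 400000

open CategoryTheory

/-- A module is uniserial if its submodules are totally ordered by inclusion. -/
def IsUniserialModule (A : Type*) [Ring A] (M : Type*) [AddCommGroup M]
    [Module A M] : Prop :=
  ∀ N N' : Submodule A M, N ≤ N' ∨ N' ≤ N

/-- A module is indecomposable if it is nonzero and admits no nontrivial direct sum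
decomposition. -/
def IsIndecomposableModule (A : Type*) [Ring A] (M : Type*) [AddCommGroup M]
    [Module A M] : Prop :=
  Nontrivial M ∧ ∀ N P : Submodule A M, IsCompl N P → N = ⊥ ∨ P = ⊥

/-- A finite dimensional algebra is a Nakayama algebra if every finitely generated
indecomposable projective module and every finitely generated indecomposable injective
module is uniserial. -/
def IsNakayamaAlgebra (A : Type) [Ring A] : Prop :=
  ∀ P : ModuleCat.{0} A, Module.Finite A P → IsIndecomposableModule A P →
    (Module.Projective A P ∨ Module.Injective A P) → IsUniserialModule A P

/-- The Loewy length of a module: the least `m` with `rad^m(M) = J(A)^m · M = 0`. -/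
noncomputable def loewyLength (A : Type*) [Ring A] (M : Type*) [AddCommGroup M]
    [Module A M] : ℕ :=
  sInf {m : ℕ | (Ideal.jacobson (⊥ : Ideal A)) ^ m • (⊤ : Submodule A M) = ⊥}

lemma hu_homology {k : Type} [Field k] (SC : ShortComplex (ModuleCat.{0} k)) {W : Type}
    [AddCommGroup W] [Module k W] (φ : W →ₗ[k] SC.X₂) (hφ : ∀ w, SC.g.hom (φ w) = 0)
    (hs : ∀ z, SC.g.hom z = 0 → ∃ w y, z = φ w + SC.f.hom y) :
    ∃ Φ : W →ₗ[k] SC.homology, Function.Surjective Φ ∧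
      ∀ w, Φ w = 0 ↔ ∃ y, φ w = SC.f.hom y := by
  let e : SC.homology ≃ₗ[k] (LinearMap.ker SC.g.hom ⧸ LinearMap.range SC.moduleCatToCycles) :=
    SC.moduleCatHomologyIso.toLinearEquiv
  let ψ : W →ₗ[k] LinearMap.ker SC.g.hom := φ.codRestrict _ hφ
  refine ⟨e.symm.toLinearMap ∘ₗ (LinearMap.range SC.moduleCatToCycles).mkQ ∘ₗ ψ, ?_, ?_⟩
  · intro v
    obtain ⟨⟨z, hz⟩, hzv⟩ := Submodule.mkQ_surjective _ (e v)
    obtain ⟨w, y, hw⟩ := hs z hz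
    refine ⟨w, ?_⟩
    simp only [LinearMap.comp_apply, LinearEquiv.coe_coe]
    rw [LinearEquiv.symm_apply_eq, ← hzv]
    rw [← sub_eq_zero, ← map_sub, Submodule.mkQ_apply, Submodule.Quotient.mk_eq_zero]
    refine ⟨-y, ?_⟩
    apply Subtype.ext
    change SC.f.hom (-y) = φ w - z
    rw [hw]; simp
  · intro w
    simp only [LinearMap.comp_apply, LinearEquiv.coe_coe]
    rw [LinearEquiv.map_eq_zero_iff, Submodule.mkQ_apply, Submodule.Quotient.mk_eq_zero]
    constructor
    · rintro ⟨y, hy⟩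
      exact ⟨y, (congrArg Subtype.val hy).symm⟩
    · rintro ⟨y, hy⟩
      exact ⟨y, Subtype.ext hy.symm⟩

open scoped ModuleCat in
lemma hu_ext_model (k : Type) [Field k] (A : Type) [Ring A] [Algebra k A]
    (m : Submodule A A) (S : ModuleCat.{0} A) :
    ∃ Φ : (m →ₗ[A] S) →ₗ[k]
        (((Ext k (ModuleCat A) 1).obj (Opposite.op (ModuleCat.of A (A ⧸ m)))).obj S),
      Function.Surjective Φ ∧ ∀ h, Φ h = 0 ↔ ∃ s : S, ∀ a : m, h a = (a : A) • s := by
  let R : ProjectiveResolution (ModuleCat.of A (A ⧸ m)) := projectiveResolution _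
  let X0 := R.complex.X 0
  let X1 := R.complex.X 1
  let X2 := R.complex.X 2
  let π : X0 →ₗ[A] (A ⧸ m) := (R.π.f 0).hom
  let d1 : X1 →ₗ[A] X0 := (R.complex.d 1 0).hom
  let d2 : X2 →ₗ[A] X1 := (R.complex.d 2 1).hom
  have hπ : Function.Surjective π := (ModuleCat.epi_iff_surjective (R.π.f 0)).1 inferInstance
  have hd : ∀ x, π (d1 x) = 0 := fun x => by
    have := R.complex_d_comp_π_f_zero
    exact congrArg (fun f => f.hom x) this
  have hdd : ∀ x, d1 (d2 x) = 0 := fun x => by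
    have := R.complex.d_comp_d 2 1 0
    exact congrArg (fun f => f.hom x) this
  have hex0 : ∀ x, π x = 0 → ∃ y, d1 y = x := by
    have := R.exact₀
    rw [ShortComplex.moduleCat_exact_iff] at this
    exact this
  have hex1 : ∀ x, d1 x = 0 → ∃ y, d2 y = x := by
    have := R.exact_succ 0
    rw [ShortComplex.moduleCat_exact_iff] at this
    exact this
  have hP : Module.Projective A X0 := by
    have := R.projective 0
    exact (IsProjective.iff_projective _).2 this
  obtain ⟨α, hα⟩ := Module.projective_lifting_property m.mkQ π m.mkQ_surjective
  obtain ⟨β, hβ⟩ := Module.projective_lifting_property π m.mkQ hπ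
  replace hα : ∀ x, m.mkQ (α x) = π x := fun x => LinearMap.congr_fun hα x
  replace hβ : ∀ x, π (β x) = m.mkQ x := fun x => LinearMap.congr_fun hβ x
  have hmem : ∀ x, α (d1 x) ∈ m := fun x => by
    rw [← Submodule.Quotient.mk_eq_zero, ← Submodule.mkQ_apply, hα, hd]
  let γ : X1 →ₗ[A] m := (α ∘ₗ d1).codRestrict m hmem
  -- the complex
  let C := R.complex.linearYonedaObj k S
  let SC := C.sc' 0 1 2
  let φ : (m →ₗ[A] S) →ₗ[k] (ModuleCat.of A X1 ⟶ S) :=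
    { toFun := fun h => ModuleCat.ofHom (h ∘ₗ γ)
      map_add' := fun f g => rfl
      map_smul' := fun c f => rfl }
  have key := hu_homology SC (W := (m →ₗ[A] S)) φ ?_ ?_
  · obtain ⟨Φ, h1, h2⟩ := key
    let e : (((Ext k (ModuleCat A) 1).obj (Opposite.op (ModuleCat.of A (A ⧸ m)))).obj S) ≃ₗ[k]
        SC.homology :=
      ((R.isoExt 1 S) ≪≫ (C.homologyIsoSc' 0 1 2 (by simp) (by simp))).toLinearEquiv
    refine ⟨e.symm.toLinearMap ∘ₗ Φ, e.symm.surjective.comp h1, fun h => ?_⟩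
    rw [LinearMap.comp_apply, LinearEquiv.coe_coe, LinearEquiv.map_eq_zero_iff, h2]
    constructor
    · rintro ⟨g, hg⟩
      change X0 ⟶ S at g
      replace hg : ∀ x : X1, h (γ x) = g.hom (d1 x) := fun x =>
        congrArg (fun f : ModuleCat.of A X1 ⟶ S => f.hom x) hg
      -- extension of h
      have hm2 : ∀ a, α (β a) - a ∈ m := fun a => by
        rw [← Submodule.Quotient.mk_eq_zero, ← Submodule.mkQ_apply, map_sub, hα, hβ, sub_self]
      let δ : A →ₗ[A] m := (α ∘ₗ β - LinearMap.id).codRestrict m hm2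
      refine ⟨g.hom (β 1) - h (δ 1), fun a => ?_⟩
      have ha : π (β a) = 0 := by
        rw [hβ, Submodule.mkQ_apply, Submodule.Quotient.mk_eq_zero]; exact a.2
      obtain ⟨y, hy⟩ := hex0 _ ha
      have h3 : γ y = δ a + a := by
        apply Subtype.ext
        simp [γ, δ, hy]
      have h4 := hg y
      rw [hy, h3, map_add] at h4
      rw [smul_sub, ← map_smul, ← map_smul, ← map_smul, ← map_smul, smul_eq_mul, mul_one, ← h4]
      simp
    · rintro ⟨s, hs⟩
      refine ⟨(ModuleCat.ofHom ((LinearMap.toSpanSingleton A S s) ∘ₗ α) : X0 ⟶ S), ?_⟩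
      change (ModuleCat.ofHom (h ∘ₗ γ) : X1 ⟶ S) = R.complex.d 1 0 ≫ _
      ext x
      change h (γ x) = α (d1 x) • s
      rw [hs]; rfl
  · intro h
    change R.complex.d 2 1 ≫ (ModuleCat.ofHom (h ∘ₗ γ) : X1 ⟶ S) = 0
    ext x
    change h (γ (d2 x)) = 0
    have : γ (d2 x) = 0 := Subtype.ext (by simp [γ, hdd])
    rw [this, map_zero]
  · intro f hf
    change X1 ⟶ S at f
    replace hf : ∀ x : X2, f.hom (d2 x) = 0 := fun x =>
      congrArg (fun f : ModuleCat.of A X2 ⟶ S => f.hom x) hf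
    -- f factors through ker π
    have hfac : ∀ x, d1 x = 0 → f.hom x = 0 := fun x hx => by
      obtain ⟨y, rfl⟩ := hex1 x hx
      exact hf y
    let K := LinearMap.range d1
    let dr : X1 →ₗ[A] K := d1.rangeRestrict
    have hdr : Function.Surjective dr := LinearMap.surjective_rangeRestrict d1
    let fb : K →ₗ[A] S :=
      ((LinearMap.ker dr).liftQ f.hom (fun x hx => hfac x (congrArg Subtype.val hx))) ∘ₗ
        (dr.quotKerEquivOfSurjective hdr).symm.toLinearMap
    have hfb : ∀ x, fb (dr x) = f.hom x := fun x => by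
      have : (dr.quotKerEquivOfSurjective hdr).symm (dr x) = Submodule.Quotient.mk x := by
        rw [LinearEquiv.symm_apply_eq]; rfl
      simp only [fb, LinearMap.comp_apply, LinearEquiv.coe_coe, this]
      rfl
    have hK : ∀ x, π x = 0 → x ∈ K := fun x hx => hex0 x hx
    let βm : m →ₗ[A] K := (β ∘ₗ m.subtype).codRestrict K (fun a => hK _ (by
      rw [LinearMap.comp_apply, hβ, Submodule.mkQ_apply, Submodule.Quotient.mk_eq_zero]; exact a.2))
    let ε : X0 →ₗ[A] K := (LinearMap.id - β ∘ₗ α).codRestrict K (fun x => hK _ (by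
      rw [LinearMap.sub_apply, map_sub, LinearMap.comp_apply, hβ, hα, LinearMap.id_apply, sub_self]))
    refine ⟨fb ∘ₗ βm, (ModuleCat.ofHom (fb ∘ₗ ε) : X0 ⟶ S), ?_⟩
    change f = (ModuleCat.ofHom ((fb ∘ₗ βm) ∘ₗ γ) : X1 ⟶ S) +
      R.complex.d 1 0 ≫ (ModuleCat.ofHom (fb ∘ₗ ε) : X0 ⟶ S)
    ext x
    change f.hom x = fb (βm (γ x)) + fb (ε (d1 x))
    rw [← map_add, ← hfb]
    congr 1
    apply Subtype.ext
    simp [βm, γ, ε, dr]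

/-- Dimension of the first extension space. -/
noncomputable def huE (k : Type) [Field k] (A : Type) [Ring A] [Algebra k A]
    (T S : ModuleCat.{0} A) : ℕ :=
  Module.finrank k (((Ext k (ModuleCat A) 1).obj (Opposite.op T)).obj S)

section
variable {k : Type} [Field k] {A : Type} [Ring A] [Algebra k A]

lemma huE_congr_left {T T' S : ModuleCat.{0} A} (e : T ≅ T') : huE k A T S = huE k A T' S :=
  (((Ext k (ModuleCat A) 1).mapIso e.op).app S).toLinearEquiv.finrank_eq.symm

lemma huE_congr_right {T S S' : ModuleCat.{0} A} (e : S ≅ S') : huE k A T S = huE k A T S' :=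
  (((Ext k (ModuleCat A) 1).obj (Opposite.op T)).mapIso e).toLinearEquiv.finrank_eq

open scoped ModuleCat in
lemma hu_ext_finite [FiniteDimensional k A] (m : Submodule A A) (S : ModuleCat.{0} A)
    (hS : IsSimpleModule A S) : Module.Finite k
      (((Ext k (ModuleCat A) 1).obj (Opposite.op (ModuleCat.of A (A ⧸ m)))).obj S) := by
  obtain ⟨Φ, h1, -⟩ := hu_ext_model k A m S
  have : Module.Finite k S := Module.Finite.trans A S
  have : Module.Finite k (m →ₗ[A] S) := by
    have : Module.Finite k m := by
      have : IsNoetherianRing A := IsNoetherianRing.of_finite k A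
      exact Module.Finite.trans A m
    let r : (m →ₗ[A] S) →ₗ[k] (m →ₗ[k] S) :=
      { toFun := fun f => f.restrictScalars k
        map_add' := fun _ _ => rfl
        map_smul' := fun _ _ => rfl }
    exact Module.Finite.of_injective r (LinearMap.restrictScalars_injective k)
  exact Module.Finite.of_surjective Φ h1

lemma hu_ne [FiniteDimensional k A] (m : Submodule A A) (S : ModuleCat.{0} A)
    (hS : IsSimpleModule A S) (h : m →ₗ[A] S) (hh : ¬ ∃ s : S, ∀ a : m, h a = (a : A) • s) :
    1 ≤ huE k A (ModuleCat.of A (A ⧸ m)) S := by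
  have := hu_ext_finite (k := k) m S hS
  obtain ⟨Φ, h1, h2⟩ := hu_ext_model k A m S
  rw [← h2] at hh
  have : Nontrivial (((Ext k (ModuleCat A) 1).obj
    (Opposite.op (ModuleCat.of A (A ⧸ m)))).obj S) := ⟨_, _, hh⟩
  exact Module.finrank_pos

lemma hu_zero [FiniteDimensional k A] (m : Submodule A A) (S : ModuleCat.{0} A)
    (hS : IsSimpleModule A S) (h0 : huE k A (ModuleCat.of A (A ⧸ m)) S = 0) (h : m →ₗ[A] S) :
    ∃ s : S, ∀ a : m, h a = (a : A) • s := by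
  by_contra hh
  have := hu_ne (k := k) m S hS h hh
  omega

open scoped ModuleCat in
lemma hu_dep [FiniteDimensional k A] (m : Submodule A A) (S : ModuleCat.{0} A)
    (hS : IsSimpleModule A S) (h0 : huE k A (ModuleCat.of A (A ⧸ m)) S ≤ 1) (f g : m →ₗ[A] S) :
    ∃ c d : k, (c ≠ 0 ∨ d ≠ 0) ∧ ∃ s : S, ∀ a : m,
      algebraMap k A c • f a + algebraMap k A d • g a = (a : A) • s := by
  have := hu_ext_finite (k := k) m S hS
  obtain ⟨Φ, h1, h2⟩ := hu_ext_model k A m S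
  have hdep : ¬ LinearIndependent k ![Φ f, Φ g] := fun hl => by
    have := hl.fintype_card_le_finrank
    simp only [Fintype.card_fin] at this
    exact absurd (this.trans h0) (by norm_num)
  rw [LinearIndependent.pair_iff] at hdep
  push Not at hdep
  obtain ⟨c, d, hcd, hne⟩ := hdep
  refine ⟨c, d, ?_, ?_⟩
  · by_cases hc : c = 0
    · exact Or.inr (hne hc)
    · exact Or.inl hc
  · rw [← map_smul, ← map_smul, ← map_add, h2] at hcd
    obtain ⟨s, hs⟩ := hcd
    exact ⟨s, fun a => hs a⟩

lemma hu_core {M S : Type} [AddCommGroup M] [Module A M] [AddCommGroup S] [Module A S]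
    [IsSimpleModule A S] (Y Z : Submodule A M) (x : M) (hx : x ∉ Y)
    (hch : ∀ N : Submodule A M, Z ≤ N → N ≤ Submodule.span A {x} ⊔ Y → N ≤ Y ∨ Y ≤ N)
    (c : Y →ₗ[A] S) (hc : c ≠ 0) (hker : ∀ y : Y, c y = 0 ↔ (y : M) ∈ Z) (hZY : Z ≤ Y)
    (m : Submodule A A) (hm : ∀ a, a ∈ m ↔ a • x ∈ Y) (h : m →ₗ[A] S)
    (hh : ∀ (a : m) (y : Y), (y : M) = (a : A) • x → h a = c y) :
    ¬ ∃ s : S, ∀ a : m, h a = (a : A) • s := by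
  rintro ⟨s, hs⟩
  obtain ⟨t, rfl⟩ := LinearMap.surjective_of_ne_zero hc s
  have hkey : ∀ a, a ∈ m → a • (x - (t : M)) ∈ Z := fun a ha => by
    have h1 := hs ⟨a, ha⟩
    rw [hh ⟨a, ha⟩ ⟨a • x, (hm a).1 ha⟩ rfl, ← map_smul, ← sub_eq_zero, ← map_sub, hker] at h1
    rw [smul_sub]
    exact h1
  apply hc
  have hy : x - (t : M) ∉ Y := fun h => hx (by simpa using Y.add_mem h t.2)
  rcases hch (Submodule.span A {x - (t : M)} ⊔ Z) le_sup_right (by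
    refine sup_le ?_ (hZY.trans le_sup_right)
    rw [Submodule.span_singleton_le_iff_mem]
    exact Submodule.sub_mem _ (Submodule.mem_sup_left (Submodule.mem_span_singleton_self x))
      (Submodule.mem_sup_right t.2)) with h1 | h1
  · exact absurd (h1 (Submodule.mem_sup_left (Submodule.mem_span_singleton_self _))) hy
  · ext y
    obtain ⟨u, hu, z, hz, huz⟩ := Submodule.mem_sup.1 (h1 y.2)
    obtain ⟨a, rfl⟩ := Submodule.mem_span_singleton.1 hu
    have ha : a • (x - (t : M)) ∈ Y := by
      rw [eq_sub_of_add_eq huz]; exact Y.sub_mem y.2 (hZY hz)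
    have ha' : a ∈ m := (hm a).2 (by
      have := Y.add_mem ha (Y.smul_mem a t.2)
      rwa [← smul_add, sub_add_cancel] at this)
    rw [LinearMap.zero_apply, hker, ← huz]
    exact Z.add_mem (hkey a ha') hz

/-- cyclic generator of a simple subquotient -/
lemma hu_cyc {M : Type} [AddCommGroup M] [Module A M] {Y E : Submodule A M} (hYE : Y ⋖ E)
    (x : M) (hxE : x ∈ E) (hx : x ∉ Y) :
    Nonempty ((A ⧸ Y.comap (LinearMap.toSpanSingleton A M x)) ≃ₗ[A] (E ⧸ Y.comap E.subtype)) := by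
  have hsimp := (covBy_iff_quot_is_simple hYE.le).1 hYE
  let f : A →ₗ[A] (E ⧸ Y.comap E.subtype) :=
    (Y.comap E.subtype).mkQ ∘ₗ LinearMap.toSpanSingleton A E ⟨x, hxE⟩
  have hf0 : ∀ a, f a = 0 ↔ a • x ∈ Y := fun a => by
    simp [f, Submodule.Quotient.mk_eq_zero]
  have hf : f ≠ 0 := fun h => hx (by
    have := (hf0 1).1 (by rw [h]; rfl)
    simpa using this)
  have hk : LinearMap.ker f = Y.comap (LinearMap.toSpanSingleton A M x) := by
    ext a
    rw [LinearMap.mem_ker, hf0]; simp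
  rw [← hk]
  exact ⟨f.quotKerEquivOfSurjective (LinearMap.surjective_of_ne_zero hf)⟩

lemma hu_fitting {P : Type} [AddCommGroup P] [Module A P] [IsArtinian A P] [IsNoetherian A P]
    (hP : IsIndecomposableModule A P) (f : Module.End A P) :
    IsNilpotent f ∨ Function.Bijective f := by
  obtain ⟨n, hn⟩ := Filter.eventually_atTop.1 f.eventually_isCompl_ker_pow_range_pow
  have h := hn (n + 1) (by omega)
  rcases hP.2 _ _ h with h1 | h1
  · right
    have hr : LinearMap.range (f ^ (n + 1)) = ⊤ := by
      have := h.sup_eq_top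
      rwa [h1, bot_sup_eq] at this
    have hb : Function.Bijective (f ^ (n + 1)) := ⟨LinearMap.ker_eq_bot.1 h1, LinearMap.range_eq_top.1 hr⟩
    rw [← Module.End.isUnit_iff] at hb ⊢
    exact (isUnit_pow_succ_iff).1 hb
  · left
    exact ⟨n + 1, LinearMap.range_eq_bot.1 h1⟩

lemma hu_proj_local {P : Type} [AddCommGroup P] [Module A P] [IsArtinian A P] [IsNoetherian A P]
    (hP : IsIndecomposableModule A P) [Module.Projective A P] (N N' : Submodule A P)
    (h : N ⊔ N' = ⊤) : N = ⊤ ∨ N' = ⊤ := by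
  let q : N →ₗ[A] (P ⧸ N') := N'.mkQ ∘ₗ N.subtype
  have hq : Function.Surjective q := by
    intro y
    obtain ⟨p, rfl⟩ := N'.mkQ_surjective y
    obtain ⟨a, ha, b, hb, rfl⟩ := Submodule.mem_sup.1 (h ▸ Submodule.mem_top : p ∈ N ⊔ N')
    refine ⟨⟨a, ha⟩, ?_⟩
    have : N'.mkQ b = 0 := by simpa using hb
    rw [map_add, this, add_zero]; rfl
  obtain ⟨g, hg⟩ := Module.projective_lifting_property q N'.mkQ hq
  let f : Module.End A P := N.subtype ∘ₗ g
  have hf : ∀ x, (1 - f) x ∈ N' := fun x => by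
    have := LinearMap.congr_fun hg x
    rw [← Submodule.Quotient.mk_eq_zero, ← Submodule.mkQ_apply, LinearMap.sub_apply, map_sub,
      Module.End.one_apply, ← this]
    exact sub_self _
  rcases hu_fitting hP f with h1 | h1
  · right
    have := h1.isUnit_one_sub
    rw [Module.End.isUnit_iff] at this
    rw [eq_top_iff]
    intro x _
    obtain ⟨y, rfl⟩ := this.2 x
    exact hf y
  · left
    rw [eq_top_iff]
    intro x _
    obtain ⟨y, rfl⟩ := h1.2 x
    exact (g y).2

lemma hu_inj_uniform {P : Type} [AddCommGroup P] [Module A P] [IsArtinian A P] [IsNoetherian A P]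
    (hP : IsIndecomposableModule A P) (hI : Module.Injective A P) (N N' : Submodule A P)
    (h : N ⊓ N' = ⊥) : N = ⊥ ∨ N' = ⊥ := by
  let i : (N × N') →ₗ[A] P := LinearMap.coprod N.subtype N'.subtype
  have hi : Function.Injective i := by
    rw [← LinearMap.ker_eq_bot, LinearMap.ker_coprod_of_disjoint_range]
    · simp
    · simpa [disjoint_iff] using h
  obtain ⟨f, hf⟩ := hI.out i hi (N.subtype ∘ₗ LinearMap.fst A N N')
  have h1 : ∀ x ∈ N, f x = x := fun x hx => by simpa [i] using hf (⟨x, hx⟩, 0)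
  have h2 : ∀ x ∈ N', f x = 0 := fun x hx => by simpa [i] using hf (0, ⟨x, hx⟩)
  rcases hu_fitting hP f with h3 | h3
  · left
    obtain ⟨n, hn⟩ := h3
    rw [eq_bot_iff]
    intro x hx
    have : ∀ n : ℕ, (f ^ n) x = x := fun n => by
      induction n with
      | zero => simp
      | succ n ih => rw [pow_succ, Module.End.mul_apply, h1 x hx, ih]
    have h4 := this n
    rw [hn] at h4
    simpa using h4.symm
  · right
    rw [eq_bot_iff]
    intro x hx
    exact h3.1 ((h2 x hx).trans (map_zero f).symm)

/-- If a simple module has no extensions by simple modules it is projective. -/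
lemma hu_projective [FiniteDimensional k A] (m : Submodule A A)
    (h0 : ∀ S : ModuleCat.{0} A, IsSimpleModule A S → huE k A (ModuleCat.of A (A ⧸ m)) S = 0) :
    Module.Projective A (A ⧸ m) := by
  have hart : IsArtinianRing A := IsArtinianRing.of_finite k A
  have hnoe : IsNoetherianRing A := IsNoetherianRing.of_finite k A
  let s : Set (Submodule A A) := {K | K ≤ m ∧ ∃ u ∈ m, ∀ a ∈ m, a - a * u ∈ K}
  obtain ⟨K, ⟨hKm, u, hu, huK⟩, hmin⟩ := WellFounded.has_min
    (wellFounded_lt (α := Submodule A A)) s ⟨m, le_rfl, 0, m.zero_mem, fun a ha => by simpa using ha⟩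
  have hK : K = ⊥ := by
    by_contra hne
    obtain ⟨K', -, hK'⟩ := exists_le_covBy_of_lt (bot_lt_iff_ne_bot.2 hne)
    have hS := (covBy_iff_quot_is_simple hK'.le).1 hK'
    let f : m →ₗ[A] K :=
      ((LinearMap.id - LinearMap.toSpanSingleton A A u) ∘ₗ m.subtype).codRestrict K
        (fun a => by simpa using huK a a.2)
    obtain ⟨t, ht⟩ := hu_zero (k := k) m (ModuleCat.of A (K ⧸ K'.comap K.subtype)) hS (h0 _ hS)
      ((K'.comap K.subtype).mkQ ∘ₗ f)
    obtain ⟨t, rfl⟩ := Submodule.mkQ_surjective _ t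
    refine hmin K' ⟨hK'.le.trans hKm, u + t, m.add_mem hu (hKm t.2), fun a ha => ?_⟩ hK'.lt
    have h1 := ht ⟨a, ha⟩
    rw [LinearMap.comp_apply, ← map_smul, ← sub_eq_zero, ← map_sub, Submodule.mkQ_apply,
      Submodule.Quotient.mk_eq_zero] at h1
    simp [f] at h1
    rw [mul_add, ← sub_sub]
    exact h1
  subst hK
  let i : (A ⧸ m) →ₗ[A] A := m.liftQ (LinearMap.id - LinearMap.toSpanSingleton A A u) (fun a ha => by
    simpa using huK a ha)
  refine Module.Projective.of_split i m.mkQ ?_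
  ext
  simp [i, hu]
end

section
variable {k : Type} [Field k] {A : Type} [Ring A] [Algebra k A]

lemma hu_proj_uniserial [FiniteDimensional k A] {P : Type} [AddCommGroup P] [Module A P]
    [IsArtinian A P] [IsNoetherian A P]
    (hloc : ∀ N N' : Submodule A P, N ⊔ N' = ⊤ → N = ⊤ ∨ N' = ⊤)
    (H1 : ∀ T S : ModuleCat.{0} A, IsSimpleModule A T → IsSimpleModule A S → huE k A T S ≤ 1)
    (H3 : ∀ T S S' : ModuleCat.{0} A, IsSimpleModule A T → IsSimpleModule A S →
      IsSimpleModule A S' → 1 ≤ huE k A T S → 1 ≤ huE k A T S' → Nonempty (S ≅ S')) :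
    IsUniserialModule A P := by
  by_contra hnon
  let s : Set (Submodule A P) := {X | ∃ N N', X ≤ N ∧ X ≤ N' ∧ ¬ (N ≤ N' ∨ N' ≤ N)}
  obtain ⟨X, ⟨N, N', hN, hN', hinc⟩, hmax⟩ := WellFounded.has_min
    (wellFounded_gt (α := Submodule A P)) s (by
      unfold IsUniserialModule at hnon
      push Not at hnon
      obtain ⟨N, N', h⟩ := hnon
      exact ⟨⊥, N, N', bot_le, bot_le, by tauto⟩)
  have hchain : ∀ Z, X < Z → ∀ N N', Z ≤ N → Z ≤ N' → N ≤ N' ∨ N' ≤ N := by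
    intro Z hZ N N' h1 h2
    by_contra h
    exact hmax Z ⟨N, N', h1, h2, h⟩ hZ
  have hNN : N ⊓ N' = X := by
    by_contra h
    exact hinc (hchain (N ⊓ N') (lt_of_le_of_ne (le_inf hN hN') (Ne.symm h)) N N' inf_le_left
      inf_le_right)
  have hXN : X < N := lt_of_le_of_ne hN (fun h => hinc (Or.inl (h ▸ hN')))
  have hXN' : X < N' := lt_of_le_of_ne hN' (fun h => hinc (Or.inr (h ▸ hN)))
  obtain ⟨S1, hS1, hS1N⟩ := exists_covBy_le_of_lt hXN
  obtain ⟨S2, hS2, hS2N⟩ := exists_covBy_le_of_lt hXN'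
  have hinf : S1 ⊓ S2 = X :=
    le_antisymm (hNN ▸ inf_le_inf hS1N hS2N) (le_inf hS1.le hS2.le)
  have hY2 : S2 ⋖ S1 ⊔ S2 := covBy_sup_of_inf_covBy_left (hinf.symm ▸ hS1)
  have hY1 : S1 ⋖ S1 ⊔ S2 := covBy_sup_of_inf_covBy_right (hinf.symm ▸ hS2)
  have hYtop : S1 ⊔ S2 ≠ ⊤ := by
    intro h
    rcases hloc _ _ h with h1 | h1
    · rw [h1, top_inf_eq] at hinf
      exact hS2.lt.ne hinf.symm
    · rw [h1, inf_top_eq] at hinf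
      exact hS1.lt.ne hinf.symm
  obtain ⟨Y, hYdef⟩ : ∃ Y, Y = S1 ⊔ S2 := ⟨_, rfl⟩
  rw [← hYdef] at hY1 hY2 hYtop
  obtain ⟨E, hYE, -⟩ := exists_covBy_le_of_lt (lt_top_iff_ne_top.2 hYtop)
  obtain ⟨x, hxE, hxY⟩ := SetLike.exists_of_lt hYE.lt
  obtain ⟨eT⟩ := hu_cyc hYE x hxE hxY
  have hE := (covBy_iff_quot_is_simple hYE.le).1 hYE
  obtain ⟨m, hmdef⟩ : ∃ m, m = Y.comap (LinearMap.toSpanSingleton A P x) := ⟨_, rfl⟩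
  rw [← hmdef] at eT
  have hT : IsSimpleModule A (A ⧸ m) := IsSimpleModule.congr eT
  have hm : ∀ a, a ∈ m ↔ a • x ∈ Y := fun a => by rw [hmdef]; simp
  let γ : m →ₗ[A] Y := (LinearMap.toSpanSingleton A P x ∘ₗ m.subtype).codRestrict Y
    (fun a => by simpa using (hm a).1 a.2)
  -- the key noninner claim
  have key : ∀ (S : ModuleCat.{0} A), IsSimpleModule A S → ∀ (c : Y →ₗ[A] S), c ≠ 0 →
      X < (LinearMap.ker c).map Y.subtype → ¬ ∃ s : S, ∀ a : m, (c ∘ₗ γ) a = (a : A) • s := by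
    intro S hS c hc hX
    refine hu_core Y ((LinearMap.ker c).map Y.subtype) x hxY ?_ c hc ?_ ?_ m hm (c ∘ₗ γ) ?_
    · intro N hN _
      exact hchain _ hX N Y hN (Submodule.map_subtype_le _ _)
    · intro y
      simp
    · exact Submodule.map_subtype_le _ _
    · intro a y hy
      rw [LinearMap.comp_apply]
      congr 1
      apply Subtype.ext
      rw [hy]; simp [γ]
  have hs1 := (covBy_iff_quot_is_simple hY2.le).1 hY2
  have hs2 := (covBy_iff_quot_is_simple hY1.le).1 hY1
  let c1 : Y →ₗ[A] (Y ⧸ S2.comap Y.subtype) := (S2.comap Y.subtype).mkQ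
  let c2 : Y →ₗ[A] (Y ⧸ S1.comap Y.subtype) := (S1.comap Y.subtype).mkQ
  have hk1 : (LinearMap.ker c1).map Y.subtype = S2 := by
    simp [c1, Submodule.map_comap_subtype, hY2.le]
  have hk2 : (LinearMap.ker c2).map Y.subtype = S1 := by
    simp [c2, Submodule.map_comap_subtype, hY1.le]
  have hc1z : ∀ y : Y, c1 y = 0 ↔ (y : P) ∈ S2 := fun y => by simp [c1]
  have hc2z : ∀ y : Y, c2 y = 0 ↔ (y : P) ∈ S1 := fun y => by simp [c2]
  obtain ⟨y1, hy1, hy1'⟩ := SetLike.exists_of_lt hY2.lt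
  obtain ⟨y2, hy2, hy2'⟩ := SetLike.exists_of_lt hY1.lt
  have hc1 : c1 ≠ 0 := fun h => hy1' ((hc1z ⟨y1, hy1⟩).1 (by rw [h]; rfl))
  have hc2 : c2 ≠ 0 := fun h => hy2' ((hc2z ⟨y2, hy2⟩).1 (by rw [h]; rfl))
  let Sg1 : ModuleCat.{0} A := ModuleCat.of A (Y ⧸ S2.comap Y.subtype)
  let Sg2 : ModuleCat.{0} A := ModuleCat.of A (Y ⧸ S1.comap Y.subtype)
  have he1 := hu_ne (k := k) m Sg1 hs1 (c1 ∘ₗ γ) (key Sg1 hs1 c1 hc1 (hk1 ▸ hS2.lt))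
  have he2 := hu_ne (k := k) m Sg2 hs2 (c2 ∘ₗ γ) (key Sg2 hs2 c2 hc2 (hk2 ▸ hS1.lt))
  obtain ⟨iso⟩ := H3 (ModuleCat.of A (A ⧸ m)) Sg2 Sg1 hT hs2 hs1 he2 he1
  let σ : (Y ⧸ S1.comap Y.subtype) ≃ₗ[A] (Y ⧸ S2.comap Y.subtype) := iso.toLinearEquiv
  obtain ⟨c, d, hcd, t, ht⟩ := hu_dep (k := k) m Sg1 hs1 (H1 _ _ hT hs1) (c1 ∘ₗ γ)
    ((σ.toLinearMap ∘ₗ c2) ∘ₗ γ)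
  -- scalar multiplication by central elements
  let sm : k → Y →ₗ[A] Y := fun r =>
    { toFun := fun y => algebraMap k A r • y
      map_add' := fun _ _ => smul_add _ _ _
      map_smul' := fun a y => by
        simp only [RingHom.id_apply, smul_smul, Algebra.commutes] }
  let cc : Y →ₗ[A] (Y ⧸ S2.comap Y.subtype) :=
    c1 ∘ₗ sm c + (σ.toLinearMap ∘ₗ c2) ∘ₗ sm d
  have hcc : ∀ y, cc y = algebraMap k A c • c1 y + algebraMap k A d • σ (c2 y) := fun y => by
    simp [cc, sm]
  have hunit : ∀ r : k, r ≠ 0 → IsUnit (algebraMap k A r) := fun r hr =>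
    (IsUnit.mk0 r hr).map (algebraMap k A)
  obtain ⟨s1, hs1S, hs1X⟩ := SetLike.exists_of_lt hS1.lt
  obtain ⟨s2, hs2S, hs2X⟩ := SetLike.exists_of_lt hS2.lt
  have hs12 : s1 ∉ S2 := fun h => hs1X (hinf ▸ ⟨hs1S, h⟩)
  have hs21 : s2 ∉ S1 := fun h => hs2X (hinf ▸ ⟨h, hs2S⟩)
  have hccne : cc ≠ 0 := by
    intro h
    rcases hcd with hc | hd
    · have h1 := hcc ⟨s1, hY1.le hs1S⟩
      rw [(hc2z ⟨s1, hY1.le hs1S⟩).2 hs1S, h, map_zero, smul_zero, add_zero, LinearMap.zero_apply,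
        eq_comm, (hunit c hc).smul_eq_zero, hc1z] at h1
      exact hs12 h1
    · have h1 := hcc ⟨s2, hY2.le hs2S⟩
      rw [(hc1z ⟨s2, hY2.le hs2S⟩).2 hs2S, h, smul_zero, zero_add, LinearMap.zero_apply,
        eq_comm, (hunit d hd).smul_eq_zero, LinearEquiv.map_eq_zero_iff, hc2z] at h1
      exact hs21 h1
  refine key Sg1 hs1 cc hccne ?_ ⟨t, fun a => ?_⟩
  · have hmem : ∀ y : Y, (y : P) ∈ (LinearMap.ker cc).map Y.subtype ↔ cc y = 0 := fun y => by simp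
    refine lt_of_le_of_ne ?_ ?_
    · intro y hy
      have hyY : y ∈ Y := hY1.le (hS1.le hy)
      rw [hmem ⟨y, hyY⟩, hcc, (hc1z ⟨y, hyY⟩).2 (hS2.le hy), (hc2z ⟨y, hyY⟩).2 (hS1.le hy)]
      simp
    · intro heq
      rw [← heq] at hmem
      -- restrict cc to S1
      let r : S1 →ₗ[A] (Y ⧸ S2.comap Y.subtype) := cc ∘ₗ Submodule.inclusion hY1.le
      have hr : r ≠ 0 := fun h => hs1X ((hmem ⟨s1, hY1.le hs1S⟩).2 (by
        have : r ⟨s1, hs1S⟩ = 0 := by rw [h]; rfl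
        exact this))
      obtain ⟨⟨u, hu⟩, hur⟩ := LinearMap.surjective_of_ne_zero hr (cc ⟨s2, hY2.le hs2S⟩)
      have : cc (⟨s2, hY2.le hs2S⟩ - ⟨u, hY1.le hu⟩) = 0 := by
        rw [map_sub, ← hur]; exact sub_self _
      rw [← hmem] at this
      apply hs21
      have h3 := S1.add_mem (hS1.le this) hu
      simpa using h3
  · rw [← ht a, LinearMap.comp_apply, hcc]
    rfl

lemma hu_inj_uniserial [FiniteDimensional k A] {P : Type} [AddCommGroup P] [Module A P]
    [IsArtinian A P] [IsNoetherian A P]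
    (huni : ∀ N N' : Submodule A P, N ⊓ N' = ⊥ → N = ⊥ ∨ N' = ⊥)
    (H1 : ∀ T S : ModuleCat.{0} A, IsSimpleModule A T → IsSimpleModule A S → huE k A T S ≤ 1)
    (H2 : ∀ T T' S : ModuleCat.{0} A, IsSimpleModule A T → IsSimpleModule A T' →
      IsSimpleModule A S → 1 ≤ huE k A T S → 1 ≤ huE k A T' S → Nonempty (T ≅ T')) :
    IsUniserialModule A P := by
  by_contra hnon
  let s : Set (Submodule A P) := {X | ∃ N N', N ≤ X ∧ N' ≤ X ∧ ¬ (N ≤ N' ∨ N' ≤ N)}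
  obtain ⟨U, ⟨N, N', hN, hN', hinc⟩, hmin⟩ := WellFounded.has_min
    (wellFounded_lt (α := Submodule A P)) s (by
      unfold IsUniserialModule at hnon
      push Not at hnon
      obtain ⟨N, N', h⟩ := hnon
      exact ⟨⊤, N, N', le_top, le_top, by tauto⟩)
  have hchain : ∀ Z, Z < U → ∀ N N', N ≤ Z → N' ≤ Z → N ≤ N' ∨ N' ≤ N := by
    intro Z hZ N N' h1 h2
    by_contra h
    exact hmin Z ⟨N, N', h1, h2, h⟩ hZ
  have hNN : N ⊔ N' = U := by
    by_contra h
    exact hinc (hchain (N ⊔ N') (lt_of_le_of_ne (sup_le hN hN') h) N N' le_sup_left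
      le_sup_right)
  have hXN : N < U := lt_of_le_of_ne hN (fun h => hinc (Or.inr (h ▸ hN')))
  have hXN' : N' < U := lt_of_le_of_ne hN' (fun h => hinc (Or.inl (h ▸ hN)))
  obtain ⟨M1, hNM1, hM1⟩ := exists_le_covBy_of_lt hXN
  obtain ⟨M2, hNM2, hM2⟩ := exists_le_covBy_of_lt hXN'
  have hsup : M1 ⊔ M2 = U :=
    le_antisymm (sup_le hM1.le hM2.le) (hNN ▸ sup_le_sup hNM1 hNM2)
  have hK2 : M1 ⊓ M2 ⋖ M2 := inf_covBy_of_covBy_sup_left (hsup.symm ▸ hM1)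
  have hK1 : M1 ⊓ M2 ⋖ M1 := inf_covBy_of_covBy_sup_right (hsup.symm ▸ hM2)
  have hKbot : M1 ⊓ M2 ≠ ⊥ := by
    intro h
    rcases huni _ _ h with h1 | h1
    · rw [h1, bot_sup_eq] at hsup
      exact hM2.lt.ne hsup
    · rw [h1, sup_bot_eq] at hsup
      exact hM1.lt.ne hsup
  obtain ⟨K, hKdef⟩ : ∃ K, K = M1 ⊓ M2 := ⟨_, rfl⟩
  have hKmem : ∀ y, y ∈ M1 → y ∈ M2 → y ∈ K := fun y h1 h2 => hKdef ▸ ⟨h1, h2⟩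
  rw [← hKdef] at hK1 hK2 hKbot
  obtain ⟨K', -, hK'⟩ := exists_le_covBy_of_lt (bot_lt_iff_ne_bot.2 hKbot)
  have hSs := (covBy_iff_quot_is_simple hK'.le).1 hK'
  let S : ModuleCat.{0} A := ModuleCat.of A (K ⧸ K'.comap K.subtype)
  let c : K →ₗ[A] (K ⧸ K'.comap K.subtype) := (K'.comap K.subtype).mkQ
  have hcz : ∀ y : K, c y = 0 ↔ (y : P) ∈ K' := fun y => by simp [c]
  obtain ⟨y0, hy0, hy0'⟩ := SetLike.exists_of_lt hK'.lt
  have hc : c ≠ 0 := fun h => hy0' ((hcz ⟨y0, hy0⟩).1 (by rw [h]; rfl))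
  -- the map attached to x
  let γ : ∀ (x : P) (m : Submodule A A) (_ : ∀ a, a ∈ m ↔ a • x ∈ K), m →ₗ[A] K := fun x m hm =>
    (LinearMap.toSpanSingleton A P x ∘ₗ m.subtype).codRestrict K
      (fun a => by simpa using (hm a).1 a.2)
  have key : ∀ (x : P) (m : Submodule A A) (hm : ∀ a, a ∈ m ↔ a • x ∈ K), x ∉ K →
      Submodule.span A {x} ⊔ K < U →
      ¬ ∃ s : S, ∀ a : m, (c ∘ₗ γ x m hm) a = (a : A) • s := by
    intro x m hm hx hlt
    refine hu_core K K' x hx ?_ c hc hcz hK'.le m hm _ ?_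
    · intro N _ hN
      exact hchain _ hlt N K hN le_sup_right
    · intro a y hy
      rw [LinearMap.comp_apply]
      congr 1
      apply Subtype.ext
      rw [hy]; simp [γ]
  have hlt : ∀ x M, M < U → K ≤ M → x ∈ M → Submodule.span A {x} ⊔ K < U := fun x M h1 h2 h3 =>
    lt_of_le_of_lt (sup_le (by rwa [Submodule.span_singleton_le_iff_mem]) h2) h1
  obtain ⟨x1, hx1, hx1K⟩ := SetLike.exists_of_lt hK1.lt
  obtain ⟨z2, hz2, hz2K⟩ := SetLike.exists_of_lt hK2.lt
  obtain ⟨e1⟩ := hu_cyc hK1 x1 hx1 hx1K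
  obtain ⟨e2⟩ := hu_cyc hK2 z2 hz2 hz2K
  obtain ⟨m1, hm1def⟩ : ∃ m, m = K.comap (LinearMap.toSpanSingleton A P x1) := ⟨_, rfl⟩
  obtain ⟨m2, hm2def⟩ : ∃ m, m = K.comap (LinearMap.toSpanSingleton A P z2) := ⟨_, rfl⟩
  rw [← hm1def] at e1
  rw [← hm2def] at e2
  have hq1 := (covBy_iff_quot_is_simple hK1.le).1 hK1
  have hq2 := (covBy_iff_quot_is_simple hK2.le).1 hK2
  have hT1 : IsSimpleModule A (A ⧸ m1) := IsSimpleModule.congr e1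
  have hT2 : IsSimpleModule A (A ⧸ m2) := IsSimpleModule.congr e2
  have hm1 : ∀ a, a ∈ m1 ↔ a • x1 ∈ K := fun a => by rw [hm1def]; simp
  have hm2 : ∀ a, a ∈ m2 ↔ a • z2 ∈ K := fun a => by rw [hm2def]; simp
  have he1 := hu_ne (k := k) m1 S hSs _ (key x1 m1 hm1 hx1K (hlt x1 M1 hM1.lt hK1.le hx1))
  have he2 := hu_ne (k := k) m2 S hSs _ (key z2 m2 hm2 hz2K (hlt z2 M2 hM2.lt hK2.le hz2))
  obtain ⟨iso⟩ := H2 (ModuleCat.of A (A ⧸ m1)) (ModuleCat.of A (A ⧸ m2)) S hT1 hT2 hSs he1 he2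
  let σ : (A ⧸ m1) ≃ₗ[A] (A ⧸ m2) := iso.toLinearEquiv
  let θ : (A ⧸ m1) ≃ₗ[A] (M2 ⧸ K.comap M2.subtype) := σ.trans e2
  obtain ⟨⟨x2, hx2⟩, hx2θ⟩ := Submodule.mkQ_surjective _ (θ (m1.mkQ 1))
  have hm1' : ∀ a, a ∈ m1 ↔ a • x2 ∈ K := fun a => by
    have h1 : θ (m1.mkQ a) = (K.comap M2.subtype).mkQ (a • ⟨x2, hx2⟩) := by
      rw [map_smul, hx2θ, ← map_smul, ← map_smul, smul_eq_mul, mul_one]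
    rw [← Submodule.Quotient.mk_eq_zero m1, ← Submodule.mkQ_apply, ← θ.map_eq_zero_iff, h1]
    simp
  obtain ⟨p, q, hpq, t, ht⟩ := hu_dep (k := k) m1 S hSs (H1 _ _ hT1 hSs) (c ∘ₗ γ x1 m1 hm1)
    (c ∘ₗ γ x2 m1 hm1')
  have hx2K : x2 ∉ K := fun h => hx1K (by
    have := (hm1 1).1 ((hm1' 1).2 (by simpa using h))
    simpa using this)
  have hunit : ∀ r : k, r ≠ 0 → ∀ y : P, algebraMap k A r • y ∈ K → y ∈ K := fun r hr y hy => by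
    have := K.smul_mem (algebraMap k A r⁻¹) hy
    rwa [smul_smul, ← map_mul, inv_mul_cancel₀ hr, map_one, one_smul] at this
  have hcomm : ∀ (r : k) (a : A) (y : P), a • algebraMap k A r • y = algebraMap k A r • a • y :=
    fun r a y => by rw [smul_smul, smul_smul, Algebra.commutes]
  obtain ⟨x, hxdef⟩ : ∃ x, x = algebraMap k A p • x1 + algebraMap k A q • x2 := ⟨_, rfl⟩
  have hax : ∀ a : A, a • x = algebraMap k A p • a • x1 + algebraMap k A q • a • x2 := fun a => by
    rw [hxdef, smul_add, hcomm, hcomm]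
  have hspl : ∀ u v, u ∈ M1 → v ∈ M2 → u + v ∈ K → u ∈ K ∧ v ∈ K := fun u v hu hv huv => by
    constructor
    · refine hKmem _ hu ?_
      have := M2.sub_mem (hK2.le huv) hv
      simpa using this
    · refine hKmem _ ?_ hv
      have := M1.sub_mem (hK1.le huv) hu
      simpa using this
  have hmx : ∀ a, a ∈ m1 ↔ a • x ∈ K := fun a => by
    constructor
    · intro h
      rw [hax]
      exact K.add_mem (K.smul_mem _ ((hm1 a).1 h)) (K.smul_mem _ ((hm1' a).1 h))
    · intro h
      rw [hax] at h
      obtain ⟨h1, h2⟩ := hspl _ _ (M1.smul_mem _ (M1.smul_mem _ hx1))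
        (M2.smul_mem _ (M2.smul_mem _ hx2)) h
      rcases hpq with hp | hq
      · exact (hm1 a).2 (hunit p hp _ h1)
      · exact (hm1' a).2 (hunit q hq _ h2)
  have hxK : x ∉ K := fun h => hx1K (by
    have := (hm1 1).1 ((hmx 1).2 (by simpa using h))
    simpa using this)
  have hxU : x ∈ U := hxdef ▸ U.add_mem (U.smul_mem _ (hM1.le hx1)) (U.smul_mem _ (hM2.le hx2))
  refine key x m1 hmx hxK ?_ ⟨t, fun a => ?_⟩
  · refine lt_of_le_of_ne (sup_le (by rwa [Submodule.span_singleton_le_iff_mem])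
      (hK1.le.trans hM1.le)) (fun heq => ?_)
    have hgen : ∀ y ∈ U, ∃ a, y - a • x ∈ K := fun y hy => by
      rw [← heq] at hy
      obtain ⟨u, hu, z, hz, huz⟩ := Submodule.mem_sup.1 hy
      obtain ⟨a, rfl⟩ := Submodule.mem_span_singleton.1 hu
      exact ⟨a, by rw [← huz]; simpa using hz⟩
    by_cases hq : q = 0
    · obtain ⟨a, ha⟩ := hgen x2 (hM2.le hx2)
      rw [hax, hq, map_zero, zero_smul, add_zero, sub_eq_neg_add] at ha
      exact hx2K (hspl _ _ (M1.neg_mem (M1.smul_mem _ (M1.smul_mem _ hx1))) hx2 ha).2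
    · obtain ⟨a, ha⟩ := hgen x1 (hM1.le hx1)
      rw [hax, ← sub_sub, sub_eq_add_neg] at ha
      obtain ⟨h1, h2⟩ := hspl _ _ (M1.sub_mem hx1 (M1.smul_mem _ (M1.smul_mem _ hx1)))
        (M2.neg_mem (M2.smul_mem _ (M2.smul_mem _ hx2))) ha
      have h3 : a ∈ m1 := (hm1' a).2 (hunit q hq _ (by simpa using h2))
      have h4 := K.add_mem h1 (K.smul_mem (algebraMap k A p) ((hm1 a).1 h3))
      exact hx1K (by simpa using h4)
  · rw [← ht a]
    simp only [LinearMap.comp_apply]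
    rw [← c.map_smul, ← c.map_smul, ← c.map_add]
    congr 1
    apply Subtype.ext
    simpa [γ] using hax a
end

section
variable {k : Type} [Field k] {A : Type} [Ring A] [Algebra k A]

lemma hu_loewy_simple {P : Type*} [AddCommGroup P] [Module A P] [IsSimpleModule A P] :
    loewyLength A P = 1 := by
  have hnt := IsSimpleModule.nontrivial A P
  have h1 : (Ideal.jacobson (⊥ : Ideal A)) ^ 1 • (⊤ : Submodule A P) = ⊥ := by
    rw [Submodule.pow_one, Ideal.jacobson_bot, eq_bot_iff]
    refine (Ring.jacobson_smul_top_le A P).trans ?_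
    rw [IsSimpleModule.jacobson_eq_bot]
  unfold loewyLength
  have hle : sInf {m : ℕ | (Ideal.jacobson (⊥ : Ideal A)) ^ m • (⊤ : Submodule A P) = ⊥} ≤ 1 :=
    Nat.sInf_le h1
  have hmem := Nat.sInf_mem (s := {m : ℕ | (Ideal.jacobson (⊥ : Ideal A)) ^ m •
    (⊤ : Submodule A P) = ⊥}) ⟨1, h1⟩
  rcases Nat.le_one_iff_eq_zero_or_eq_one.1 hle with h | h
  · rw [h] at hmem
    have hmem2 : (Ideal.jacobson (⊥ : Ideal A)) ^ 0 • (⊤ : Submodule A P) = ⊥ := hmem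
    rw [Submodule.pow_zero, Ideal.one_eq_top, Submodule.top_smul] at hmem2
    exact absurd hmem2 top_ne_bot
  · exact h

lemma hu_loewy_one [IsArtinianRing A] {P : Type*} [AddCommGroup P] [Module A P]
    (h : loewyLength A P = 1) : IsSemisimpleModule A P := by
  have hne : {m : ℕ | (Ideal.jacobson (⊥ : Ideal A)) ^ m •
    (⊤ : Submodule A P) = ⊥}.Nonempty := by
    by_contra hn
    rw [Set.not_nonempty_iff_eq_empty] at hn
    simp [loewyLength, hn] at h
  have hmem := Nat.sInf_mem hne
  change loewyLength A P ∈ _ at hmem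
  rw [h] at hmem
  have hmem2 : (Ideal.jacobson (⊥ : Ideal A)) ^ 1 • (⊤ : Submodule A P) = ⊥ := hmem
  rw [Submodule.pow_one, Ideal.jacobson_bot] at hmem2
  have hT : Module.IsTorsionBySet A P (Ring.jacobson A) := by
    intro x a
    have : (a : A) • x ∈ Ring.jacobson A • (⊤ : Submodule A P) :=
      Submodule.smul_mem_smul a.2 trivial
    rw [hmem2] at this
    simpa using this
  let _ := hT.module
  have := hT.isSemisimpleModule_iff
  rw [← this]
  have : IsSemisimpleRing (A ⧸ Ring.jacobson A) := IsSemiprimaryRing.isSemisimpleRing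
  infer_instance

lemma hu_ss_uniserial {P : Type*} [AddCommGroup P] [Module A P] [IsSemisimpleModule A P]
    (hP : IsIndecomposableModule A P) : IsUniserialModule A P := by
  intro N N'
  obtain ⟨C, hC⟩ := exists_isCompl N
  rcases hP.2 N C hC with h | h
  · left; rw [h]; exact bot_le
  · right
    have : N = ⊤ := by simpa [h] using hC.sup_eq_top
    rw [this]; exact le_top

lemma hu_indec_congr {P Q : Type*} [AddCommGroup P] [Module A P] [AddCommGroup Q] [Module A Q]
    (e : P ≃ₗ[A] Q) (hP : IsIndecomposableModule A P) : IsIndecomposableModule A Q := by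
  have := hP.1
  refine ⟨e.symm.toEquiv.nontrivial, fun N N' h => ?_⟩
  let o := Submodule.orderIsoMapComap e.symm
  have h2 : IsCompl (o N) (o N') := o.isCompl h
  exact (hP.2 _ _ h2).imp (fun h => by simpa using h) (fun h => by simpa using h)

lemma hu_simple_indec {P : Type*} [AddCommGroup P] [Module A P] [IsSimpleModule A P] :
    IsIndecomposableModule A P := by
  have hnt := IsSimpleModule.nontrivial A P
  refine ⟨hnt, fun N N' h => ?_⟩
  rcases eq_bot_or_eq_top N with h1 | h1
  · exact Or.inl h1
  · right
    simpa [h1] using h.inf_eq_bot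
end

/-- Huppert's criterion, contrapositive form: let `A` be a finite
dimensional algebra over an algebraically closed field which is not Nakayama, all of
whose projective indecomposable modules have the same Loewy length.  Then there is a
simple module `S` with `∑_T dim_k Ext¹_A(T, S) ≥ 2`, `T` ranging over a set of
representatives of the isomorphism classes of simple `A`-modules. -/
theorem huppert_ext_sum_ge_two
    (k : Type) [Field k] [IsAlgClosed k]
    (A : Type) [Ring A] [Algebra k A] [FiniteDimensional k A]
    (hNak : ¬ IsNakayamaAlgebra A)
    (hLoewy : ∃ L : ℕ, ∀ P : ModuleCat A, Module.Finite A P →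
      Module.Projective A P → IsIndecomposableModule A P → loewyLength A P = L) :
    ∃ S : ModuleCat A, IsSimpleModule A S ∧
      ∀ (m : ℕ) (T : Fin m → ModuleCat A),
        (∀ i, IsSimpleModule A (T i)) →
        (∀ i j, i ≠ j → IsEmpty (T i ≅ T j)) →
        (∀ X : ModuleCat A, IsSimpleModule A X → ∃ i, Nonempty (X ≅ T i)) →
        2 ≤ ∑ i, Module.finrank k
          (((Ext k (ModuleCat A) 1).obj (Opposite.op (T i))).obj S) := by
  by_contra hcon
  have hE : ∀ S : ModuleCat.{0} A, IsSimpleModule A S → ∃ (m : ℕ) (T : Fin m → ModuleCat.{0} A),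
      (∀ i, IsSimpleModule A (T i)) ∧ (∀ i j, Nonempty (T i ≅ T j) → i = j) ∧
      (∀ X : ModuleCat.{0} A, IsSimpleModule A X → ∃ i, Nonempty (X ≅ T i)) ∧
      ∑ i, huE k A (T i) S ≤ 1 := by
    intro S hS
    by_contra hno
    refine hcon ⟨S, hS, fun m T h1 h2 h3 => ?_⟩
    by_contra hlt
    refine hno ⟨m, T, h1, fun i j hij => ?_, h3, ?_⟩
    · by_contra hne
      exact (h2 i j hne).false hij.some
    · exact Nat.le_of_lt_succ (not_le.1 hlt)
  clear hcon
  have H1 : ∀ T S : ModuleCat.{0} A, IsSimpleModule A T → IsSimpleModule A S →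
      huE k A T S ≤ 1 := by
    intro T S hT hS
    obtain ⟨m, Ts, h1, h2, h3, h4⟩ := hE S hS
    obtain ⟨i, ⟨e⟩⟩ := h3 T hT
    rw [huE_congr_left e]
    exact (Finset.single_le_sum (f := fun i => huE k A (Ts i) S) (fun _ _ => Nat.zero_le _)
      (Finset.mem_univ i)).trans h4
  have H2 : ∀ T T' S : ModuleCat.{0} A, IsSimpleModule A T → IsSimpleModule A T' →
      IsSimpleModule A S → 1 ≤ huE k A T S → 1 ≤ huE k A T' S → Nonempty (T ≅ T') := by
    intro T T' S hT hT' hS hp hp'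
    obtain ⟨m, Ts, h1, h2, h3, h4⟩ := hE S hS
    obtain ⟨i, ⟨e⟩⟩ := h3 T hT
    obtain ⟨j, ⟨e'⟩⟩ := h3 T' hT'
    rw [huE_congr_left e] at hp
    rw [huE_congr_left e'] at hp'
    by_cases hij : i = j
    · subst hij
      exact ⟨e ≪≫ e'.symm⟩
    · exfalso
      have := Finset.add_le_sum (f := fun i => huE k A (Ts i) S) (fun _ _ => Nat.zero_le _)
        (Finset.mem_univ i) (Finset.mem_univ j) hij
      omega
  have : IsArtinianRing A := IsArtinianRing.of_finite k A
  have : IsNoetherianRing A := IsNoetherianRing.of_finite k A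
  unfold IsNakayamaAlgebra at hNak
  push Not at hNak
  obtain ⟨P, hfin, hind, hPI, hnu⟩ := hNak
  rcases hPI with hproj | hinj
  swap
  · exact hnu (hu_inj_uniserial (k := k) (hu_inj_uniform hind hinj) H1 H2)
  have hntP := hind.1
  have hntA : Nontrivial A := Module.nontrivial A P
  obtain ⟨m0, hm0⟩ := Ideal.exists_maximal A
  have hsimp0 : IsSimpleModule A (A ⧸ m0) := isSimpleModule_iff_isCoatom.2 hm0.out
  obtain ⟨n, Ts, h1, h2, h3, -⟩ := hE (ModuleCat.of A (A ⧸ m0)) hsimp0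
  by_cases hcase : ∀ i, ∃ j, 1 ≤ huE k A (Ts i) (Ts j)
  · choose s hs using hcase
    have hinj : Function.Injective s := by
      intro i j hij
      refine h2 i j (H2 _ _ (Ts (s i)) (h1 i) (h1 j) (h1 _) (hs i) ?_)
      rw [hij]; exact hs j
    have hsurj := Finite.surjective_of_injective hinj
    refine hnu (hu_proj_uniserial (k := k) (hu_proj_local hind) H1 ?_)
    have hlift : ∀ T S : ModuleCat.{0} A, IsSimpleModule A T → IsSimpleModule A S →
        1 ≤ huE k A T S → ∃ i, Nonempty (T ≅ Ts i) ∧ Nonempty (S ≅ Ts (s i)) := by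
      intro T S hT hS h
      obtain ⟨j, ⟨e⟩⟩ := h3 S hS
      obtain ⟨i, rfl⟩ := hsurj j
      refine ⟨i, H2 _ _ S hT (h1 i) hS h ?_, ⟨e⟩⟩
      rw [huE_congr_right e]; exact hs i
    intro T S S' hT hS hS' h h'
    obtain ⟨i, ⟨e1⟩, ⟨e2⟩⟩ := hlift T S hT hS h
    obtain ⟨j, ⟨f1⟩, ⟨f2⟩⟩ := hlift T S' hT hS' h'
    obtain rfl := h2 i j ⟨e1.symm ≪≫ f1⟩
    exact ⟨e2 ≪≫ f2.symm⟩
  · push Not at hcase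
    obtain ⟨i, hi⟩ := hcase
    obtain ⟨L, hL⟩ := hLoewy
    obtain ⟨m, hm, ⟨e⟩⟩ := isSimpleModule_iff_quot_maximal.1 (h1 i)
    have hsm : IsSimpleModule A (A ⧸ m) := isSimpleModule_iff_isCoatom.2 hm.out
    have hpr : Module.Projective A (A ⧸ m) := by
      refine hu_projective (k := k) m (fun S hS => ?_)
      obtain ⟨j, ⟨f⟩⟩ := h3 S hS
      have e' : ModuleCat.of A (A ⧸ m) ≅ Ts i := e.symm.toModuleIso
      rw [huE_congr_left e', huE_congr_right f]
      have := hi j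
      omega
    have hL1 := hL (ModuleCat.of A (ULift (A ⧸ m)))
      (Module.Finite.equiv (ULift.moduleEquiv (R := A) (M := A ⧸ m)).symm)
      (Module.Projective.of_equiv (ULift.moduleEquiv (R := A) (M := A ⧸ m)).symm)
      (hu_indec_congr (ULift.moduleEquiv (R := A) (M := A ⧸ m)).symm hu_simple_indec)
    have hsu : IsSimpleModule A (ULift (A ⧸ m)) :=
      IsSimpleModule.congr (ULift.moduleEquiv (R := A) (M := A ⧸ m))
    have hL2 := hL (ModuleCat.of A (ULift P))
      (Module.Finite.equiv (ULift.moduleEquiv (R := A) (M := P)).symm)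
      (Module.Projective.of_equiv (ULift.moduleEquiv (R := A) (M := P)).symm)
      (hu_indec_congr (ULift.moduleEquiv (R := A) (M := P)).symm hind)
    rw [← hL1] at hL2
    have hss : IsSemisimpleModule A (ULift P) := hu_loewy_one (hL2.trans hu_loewy_simple)
    have hssP : IsSemisimpleModule A P :=
      IsSemisimpleModule.congr (ULift.moduleEquiv (R := A) (M := P)).symm
    exact hnu (hu_ss_uniserial hind)
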